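/- Let A have finite global dimension d and let P be a 2-term silting complex in K^b(proj A) such that the A-module H^0(P) has projective dimension at most 1. Then C(P) ⊆ 𝒫 * 𝒫[1] * ... * 𝒫[d] * add H^0(P)[d+1], where 𝒫 = add P. -/

import Mathlib

/-!
Common setup: we model right `A`-modules as `ModuleCat Aᵐᵒᵖ`, the bounded derived
category `D^b(mod A)` as the full subcategory (given by the predicate `InDb`) of the
derived category of `Mod Aᵐᵒᵖ` consisting of cohomologically bounded complexes with
finitely generated cohomology, and `K^b(proj A)` via bounded complexes of finitely
generated projective modules (`IsPerfCplx`).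
-/

namespace TwoTermSilting

open CategoryTheory Limits Pretriangulated

universe w v u

noncomputable section

/-- The projective dimension of the module `M` is at most `n`. -/
def pdLE (R : Type u) [Ring R] : ℕ → ModuleCat.{v} R → Prop
  | 0, M => Projective M
  | (n+1), M => ∃ (P : ModuleCat.{v} R) (f : P ⟶ M),
      Projective P ∧ Epi f ∧ pdLE R n (kernel f)

/-- The (right) global dimension of `R` is at most `d`: every finitely generated
module has projective dimension at most `d`. -/
def gldLE (R : Type u) [Ring R] (d : ℕ) : Prop :=
  ∀ M : ModuleCat.{v} R, Module.Finite R M → pdLE R d M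

section Star

variable {C : Type u} [Category.{v} C] [HasZeroObject C] [Preadditive C] [HasShift C ℤ]
  [∀ n : ℤ, (shiftFunctor C n).Additive] [Pretriangulated C]

/-- `star S T` consists of the objects `Z` sitting in a distinguished triangle
`X ⟶ Z ⟶ Y ⟶ X⟦1⟧` with `X ∈ S` and `Y ∈ T`. -/
def star (S T : Set C) : Set C :=
  {Z | ∃ (X Y : C) (f : X ⟶ Z) (g : Z ⟶ Y) (h : Y ⟶ X⟦(1 : ℤ)⟧),
    X ∈ S ∧ Y ∈ T ∧ Triangle.mk f g h ∈ distTriang C}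

/-- `starChain f n` is the iterated star product `f 0 * f 1 * ⋯ * f n`
(the star operation being associative). -/
def starChain (f : ℕ → Set C) : ℕ → Set C
  | 0 => f 0
  | (n+1) => star (starChain f n) (f (n+1))

/-- The closure of a class of objects under the shift by `n`. -/
def shiftSet (S : Set C) (n : ℤ) : Set C :=
  {Y | ∃ X ∈ S, Nonempty (Y ≅ X⟦n⟧)}

/-- The additive closure of the object `X`: all direct summands of finite direct sums
of copies of `X`. -/
def addOf (X : C) : Set C :=
  {Y | ∃ (n : ℕ) (ι : Y ⟶ ⨁ (fun _ : Fin n => X)) (r : (⨁ (fun _ : Fin n => X)) ⟶ Y),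
    ι ≫ r = 𝟙 Y}

/-- A class of objects of a (pre)triangulated category is thick if it is closed under
isomorphisms, shifts, extensions and direct summands. -/
def IsThick (S : Set C) : Prop :=
  (∀ ⦃X Y : C⦄, (X ≅ Y) → X ∈ S → Y ∈ S) ∧
  (∀ (X : C) (n : ℤ), X ∈ S → (X⟦n⟧) ∈ S) ∧
  (∀ T : Triangle C, (T ∈ distTriang C) → T.obj₁ ∈ S → T.obj₃ ∈ S → T.obj₂ ∈ S) ∧
  (∀ (X Y : C) (ι : X ⟶ Y) (r : Y ⟶ X), ι ≫ r = 𝟙 X → Y ∈ S → X ∈ S)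

end Star

/-- The right `End Y`-module structure on `Y ⟶ X`, by precomposition. -/
instance endModule {C : Type u} [Category.{v} C] [Preadditive C] (Y X : C) :
    Module (End Y)ᵐᵒᵖ (Y ⟶ X) where
  smul b f := b.unop ≫ f
  one_smul f := Category.id_comp f
  mul_smul b₁ b₂ f := by
    show (b₁ * b₂).unop ≫ f = b₁.unop ≫ (b₂.unop ≫ f)
    have h : (b₁ * b₂).unop = b₁.unop ≫ b₂.unop := rfl
    rw [h, Category.assoc]
  smul_zero b := Limits.comp_zero
  smul_add b f g := Preadditive.comp_add _ _ _ _ _ _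
  add_smul b₁ b₂ f := Preadditive.add_comp _ _ _ _ _ _
  zero_smul f := Limits.zero_comp

section Main

variable (R : Type) [Ring R] [HasDerivedCategory.{w} (ModuleCat.{0} R)]

/-- A bounded complex of finitely generated projective modules
(an object of `K^b(proj R)`). -/
def IsPerfCplx (X : CochainComplex (ModuleCat.{0} R) ℤ) : Prop :=
  (∀ i, Projective (X.X i)) ∧ (∀ i, Module.Finite R (X.X i)) ∧
    ∃ a b : ℤ, ∀ i, (i < a ∨ b < i) → IsZero (X.X i)

/-- A complex of finitely generated projective modules concentrated in
degrees `-1` and `0`. -/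
def IsTwoTermCplx (X : CochainComplex (ModuleCat.{0} R) ℤ) : Prop :=
  (∀ i, Projective (X.X i)) ∧ (∀ i, Module.Finite R (X.X i)) ∧
    ∀ i, i ≠ -1 → i ≠ 0 → IsZero (X.X i)

/-- A two-term silting complex: a two-term complex of finitely generated projectives `P`
with `Hom_D(P, P[1]) = 0`, such that the smallest thick subcategory containing `P`
contains all of `K^b(proj R)`. -/
def IsTwoTermSilting (P : CochainComplex (ModuleCat.{0} R) ℤ) : Prop :=
  IsTwoTermCplx R P ∧
  (∀ f : DerivedCategory.Q.obj P ⟶ (DerivedCategory.Q.obj P)⟦(1 : ℤ)⟧, f = 0) ∧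
  (∀ S : Set (DerivedCategory (ModuleCat.{0} R)), IsThick S →
    DerivedCategory.Q.obj P ∈ S →
    ∀ X : CochainComplex (ModuleCat.{0} R) ℤ, IsPerfCplx R X → DerivedCategory.Q.obj X ∈ S)

/-- The objects of the derived category which belong to `D^b(mod R)`: cohomologically
bounded complexes with finitely generated cohomology. -/
def InDb (X : DerivedCategory (ModuleCat.{0} R)) : Prop :=
  (∃ a b : ℤ, ∀ i, (i < a ∨ b < i) →
    IsZero ((DerivedCategory.homologyFunctor (ModuleCat.{0} R) i).obj X)) ∧
  (∀ i : ℤ, Module.Finite R ((DerivedCategory.homologyFunctor (ModuleCat.{0} R) i).obj X))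

variable {R}

/-- The torsion class `T(P)` of finitely generated modules `X` with `Hom_D(P, X[1]) = 0`. -/
def TT (P : CochainComplex (ModuleCat.{0} R) ℤ) : Set (ModuleCat.{0} R) :=
  {X | Module.Finite R X ∧
    ∀ f : DerivedCategory.Q.obj P ⟶
      ((DerivedCategory.singleFunctor (ModuleCat.{0} R) 0).obj X)⟦(1 : ℤ)⟧, f = 0}

/-- The torsion-free class `F(P)` of finitely generated modules `Y` with `Hom_D(P, Y) = 0`. -/
def FF (P : CochainComplex (ModuleCat.{0} R) ℤ) : Set (ModuleCat.{0} R) :=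
  {Y | Module.Finite R Y ∧
    ∀ f : DerivedCategory.Q.obj P ⟶
      (DerivedCategory.singleFunctor (ModuleCat.{0} R) 0).obj Y, f = 0}

/-- The heart `C(P) = {X ∈ D^b(mod R) | Hom_D(P, X[i]) = 0 for all i ≠ 0}`. -/
def CP (P : CochainComplex (ModuleCat.{0} R) ℤ) : Set (DerivedCategory (ModuleCat.{0} R)) :=
  {X | InDb R X ∧ ∀ i : ℤ, i ≠ 0 → ∀ f : DerivedCategory.Q.obj P ⟶ X⟦i⟧, f = 0}

end Main

set_option linter.unusedSectionVars false

section Abstract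

variable {C : Type u} [Category.{v} C] [HasZeroObject C] [Preadditive C] [HasShift C ℤ]
  [∀ n : ℤ, (shiftFunctor C n).Additive] [Pretriangulated C]

/-- All morphisms `X ⟶ Y⟦n⟧` vanish. -/
def HomVanish (X Y : C) (n : ℤ) : Prop := ∀ f : X ⟶ Y⟦n⟧, f = 0

namespace HomVanish

variable {X Y : C} {n : ℤ}

lemma of_retract_left {X' : C} (h : HomVanish X Y n) (s : X' ⟶ X) (r : X ⟶ X')
    (hsr : s ≫ r = 𝟙 X') : HomVanish X' Y n := fun f => by
  rw [← Category.id_comp f, ← hsr, Category.assoc, h (r ≫ f), comp_zero]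

lemma of_retract_right {Y' : C} (h : HomVanish X Y n) (s : Y' ⟶ Y) (r : Y ⟶ Y')
    (hsr : s ≫ r = 𝟙 Y') : HomVanish X Y' n := fun f => by
  have : s⟦n⟧' ≫ r⟦n⟧' = 𝟙 _ := by rw [← Functor.map_comp, hsr, CategoryTheory.Functor.map_id]
  rw [← Category.comp_id f, ← this, ← Category.assoc, h (f ≫ s⟦n⟧'), zero_comp]

lemma of_iso_left {X' : C} (h : HomVanish X Y n) (e : X' ≅ X) : HomVanish X' Y n :=
  h.of_retract_left e.hom e.inv e.hom_inv_id

lemma of_iso_right {Y' : C} (h : HomVanish X Y n) (e : Y' ≅ Y) : HomVanish X Y' n :=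
  h.of_retract_right e.hom e.inv e.hom_inv_id

lemma shift_right {a m : ℤ} (h : HomVanish X Y m) (hm : a + n = m) :
    HomVanish X (Y⟦a⟧) n := fun f => by
  rw [← cancel_mono ((shiftFunctorAdd' C a n m hm).inv.app Y), zero_comp]
  exact h _

lemma shift_left {a m : ℤ} (h : HomVanish X Y m) (hm : m + a = n) :
    HomVanish (X⟦a⟧) Y n := fun f => by
  obtain ⟨g, hg⟩ := (shiftFunctor C a).map_surjective
    (f ≫ (shiftFunctorAdd' C m a n hm).hom.app Y)
  rw [h g, Functor.map_zero] at hg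
  rw [← cancel_mono ((shiftFunctorAdd' C m a n hm).hom.app Y), zero_comp]
  exact hg.symm

lemma of_triangle_left (T : Triangle C) (hT : T ∈ distTriang C)
    (h₁ : HomVanish T.obj₁ Y n) (h₃ : HomVanish T.obj₃ Y n) : HomVanish T.obj₂ Y n := fun f => by
  obtain ⟨g, rfl⟩ := T.yoneda_exact₂ hT f (h₁ _)
  rw [h₃ g, comp_zero]

lemma of_triangle_left₃ (T : Triangle C) (hT : T ∈ distTriang C) {m : ℤ} (hm : m + 1 = n)
    (h₂ : HomVanish T.obj₂ Y n) (h₁ : HomVanish T.obj₁ Y m) : HomVanish T.obj₃ Y n :=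
  of_triangle_left _ (rot_of_distTriang _ hT) h₂ (h₁.shift_left hm)

lemma of_triangle_left₁ (T : Triangle C) (hT : T ∈ distTriang C) {m : ℤ} (hm : n + 1 = m)
    (h₂ : HomVanish T.obj₂ Y n) (h₃ : HomVanish T.obj₃ Y m) : HomVanish T.obj₁ Y n :=
  of_triangle_left _ (inv_rot_of_distTriang _ hT) (h₃.shift_left (by lia)) h₂

lemma of_triangle_right (T : Triangle C) (hT : T ∈ distTriang C)
    (h₁ : HomVanish X T.obj₁ n) (h₃ : HomVanish X T.obj₃ n) : HomVanish X T.obj₂ n := fun f => by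
  obtain ⟨g, hg⟩ := Triangle.coyoneda_exact₂ _ (T.shift_distinguished hT n) f (h₃ _)
  rw [hg]
  exact (congrArg (· ≫ _) (h₁ g)).trans zero_comp

lemma of_triangle_right₃ (T : Triangle C) (hT : T ∈ distTriang C) {m : ℤ} (hm : n + 1 = m)
    (h₂ : HomVanish X T.obj₂ n) (h₁ : HomVanish X T.obj₁ m) : HomVanish X T.obj₃ n :=
  of_triangle_right _ (rot_of_distTriang _ hT) h₂ (h₁.shift_right (by lia))

lemma of_triangle_right₁ (T : Triangle C) (hT : T ∈ distTriang C) {m : ℤ} (hm : m + 1 = n)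
    (h₂ : HomVanish X T.obj₂ n) (h₃ : HomVanish X T.obj₃ m) : HomVanish X T.obj₁ n :=
  of_triangle_right _ (inv_rot_of_distTriang _ hT) (h₃.shift_right (by lia)) h₂

lemma of_left_approximation (T : Triangle C) (hT : T ∈ distTriang C) {m : ℤ} (hm : n + 1 = m)
    (h : ∀ f : T.obj₂ ⟶ Y⟦n⟧, ∃ g : T.obj₃ ⟶ Y⟦n⟧, f = T.mor₂ ≫ g)
    (h₃ : HomVanish T.obj₃ Y m) : HomVanish T.obj₁ Y n := fun f => by
  obtain ⟨g, hg⟩ := Triangle.yoneda_exact₂ _ (inv_rot_of_distTriang _ hT) f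
    (h₃.shift_left (by lia) _)
  obtain ⟨g', rfl⟩ := h g
  rw [hg]
  exact (Category.assoc _ _ _).symm.trans
    ((congrArg (· ≫ g') (comp_distTriang_mor_zero₁₂ _ hT)).trans zero_comp)

lemma biproduct_left {m : ℕ} (h : HomVanish X Y n) :
    HomVanish (⨁ (fun _ : Fin m => X)) Y n := fun f =>
  biproduct.hom_ext' _ _ fun j => by rw [comp_zero]; exact h _

lemma biproduct_right {m : ℕ} (h : HomVanish X Y n) :
    HomVanish X (⨁ (fun _ : Fin m => Y)) n := fun f => by
  have e : 𝟙 ((⨁ (fun _ : Fin m => Y))⟦n⟧) =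
      ∑ j, (biproduct.π (fun _ : Fin m => Y) j)⟦n⟧' ≫ (biproduct.ι (fun _ : Fin m => Y) j)⟦n⟧' := by
    simp_rw [← Functor.map_comp]
    rw [← Functor.map_sum, biproduct.total, CategoryTheory.Functor.map_id]
  rw [← Category.comp_id f, e, Preadditive.comp_sum]
  exact Finset.sum_eq_zero fun j _ => by rw [← Category.assoc, h (f ≫ _), zero_comp]

lemma left_of_mem_addOf {X' : C} (h : HomVanish X Y n) (hX' : X' ∈ addOf X) :
    HomVanish X' Y n := by
  obtain ⟨m, s, r, hsr⟩ := hX'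
  exact h.biproduct_left.of_retract_left s r hsr

end HomVanish

/-- The smallest thick class of objects containing `G`. -/
def thickClosure (G : Set C) : Set C := {W | ∀ S : Set C, IsThick S → G ⊆ S → W ∈ S}

lemma isThick_thickClosure (G : Set C) : IsThick (thickClosure G) :=
  ⟨fun _ _ e h S hS hG => hS.1 e (h S hS hG), fun X n h S hS hG => hS.2.1 X n (h S hS hG),
    fun T hT h₁ h₃ S hS hG => hS.2.2.1 T hT (h₁ S hS hG) (h₃ S hS hG),
    fun X Y s r hsr h S hS hG => hS.2.2.2 X Y s r hsr (h S hS hG)⟩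

lemma subset_thickClosure (G : Set C) : G ⊆ thickClosure G := fun _ h _ _ hG => hG h

namespace IsThick

variable {S : Set C} (hS : IsThick S)
include hS

lemma obj₁_mem (T : Triangle C) (hT : T ∈ distTriang C) (h₂ : T.obj₂ ∈ S) (h₃ : T.obj₃ ∈ S) :
    T.obj₁ ∈ S :=
  hS.2.2.1 _ (inv_rot_of_distTriang _ hT) (hS.2.1 _ _ h₃) h₂

lemma obj₃_mem (T : Triangle C) (hT : T ∈ distTriang C) (h₁ : T.obj₁ ∈ S) (h₂ : T.obj₂ ∈ S) :
    T.obj₃ ∈ S :=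
  hS.2.2.1 _ (rot_of_distTriang _ hT) h₂ (hS.2.1 _ _ h₁)

lemma zero_mem {X Z : C} (hX : X ∈ S) (hZ : IsZero Z) : Z ∈ S :=
  hS.2.2.2 Z X 0 0 (hZ.eq_of_src _ _) hX

lemma biprod_mem {X Y : C} (hX : X ∈ S) (hY : Y ∈ S) : (X ⊞ Y) ∈ S :=
  hS.2.2.1 _ (binaryBiproductTriangle_distinguished X Y) hX hY

lemma biproduct_mem {X : C} (hX : X ∈ S) (n : ℕ) : (⨁ (fun _ : Fin n => X)) ∈ S := by
  induction n with
  | zero => exact hS.zero_mem hX ((IsZero.iff_id_eq_zero _).2 (biproduct.hom_ext _ _ fun j => j.elim0))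
  | succ n ih =>
    refine hS.2.2.2 _ ((⨁ (fun _ : Fin n => X)) ⊞ X)
      (biprod.lift (biproduct.lift fun j => biproduct.π (fun _ : Fin (n + 1) => X) j.castSucc)
        (biproduct.π (fun _ : Fin (n + 1) => X) (Fin.last n)))
      (biprod.desc (biproduct.desc fun j => biproduct.ι (fun _ : Fin (n + 1) => X) j.castSucc)
        (biproduct.ι (fun _ : Fin (n + 1) => X) (Fin.last n))) ?_ (hS.biprod_mem ih hX)
    rw [biprod.lift_desc, biproduct.lift_desc, ← biproduct.total, Fin.sum_univ_castSucc]

end IsThick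

/-- If morphisms out of `W` into positive shifts of members of `A` are eventually zero
for a generator, they are so for the thick class it generates. -/
lemma exists_homVanish_of_mem_thickClosure {P W : C} (hW : W ∈ thickClosure {P}) (A : Set C)
    (hA : ∀ Z ∈ A, ∀ i : ℤ, 0 < i → HomVanish P Z i) :
    ∃ m : ℤ, ∀ Z ∈ A, ∀ i : ℤ, m < i → HomVanish W Z i := by
  refine hW {W | ∃ m : ℤ, ∀ Z ∈ A, ∀ i : ℤ, m < i → HomVanish W Z i} ⟨?_, ?_, ?_, ?_⟩ ?_
  · rintro X Y e ⟨m, hm⟩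
    exact ⟨m, fun Z hZ i hi => (hm Z hZ i hi).of_iso_left e.symm⟩
  · rintro X n ⟨m, hm⟩
    exact ⟨m + n, fun Z hZ i hi => (hm Z hZ (i - n) (by lia)).shift_left (by lia)⟩
  · rintro T hT ⟨m₁, h₁⟩ ⟨m₃, h₃⟩
    exact ⟨max m₁ m₃, fun Z hZ i hi => HomVanish.of_triangle_left T hT
      (h₁ Z hZ i (by lia)) (h₃ Z hZ i (by lia))⟩
  · rintro X Y s r hsr ⟨m, hm⟩
    exact ⟨m, fun Z hZ i hi => (hm Z hZ i hi).of_retract_left s r hsr⟩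
  · rintro _ rfl
    exact ⟨0, hA⟩

lemma mem_shiftSet_biproduct (P : C) (m : ℕ) (n : ℤ) :
    (⨁ (fun _ : Fin m => P))⟦n⟧ ∈ shiftSet (addOf P) n :=
  ⟨_, ⟨m, 𝟙 _, 𝟙 _, Category.id_comp _⟩, ⟨Iso.refl _⟩⟩

variable (k : Type*) [Field k] [Linear k C]

lemma exists_left_approximation (W P : C) (n : ℤ) [Module.Finite k (W ⟶ P⟦n⟧)] :
    ∃ (m : ℕ) (α : W ⟶ (⨁ (fun _ : Fin m => P))⟦n⟧),
      ∀ f : W ⟶ P⟦n⟧, ∃ g : (⨁ (fun _ : Fin m => P))⟦n⟧ ⟶ P⟦n⟧, f = α ≫ g := by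
  obtain ⟨m, b, hb⟩ := Module.Finite.exists_fin (R := k) (M := W ⟶ P⟦n⟧)
  refine ⟨m, ∑ j, b j ≫ (biproduct.ι (fun _ : Fin m => P) j)⟦n⟧', fun f => ?_⟩
  obtain ⟨c, rfl⟩ := (Submodule.mem_span_range_iff_exists_fun k).1
    (hb ▸ Submodule.mem_top : f ∈ Submodule.span k (Set.range b))
  refine ⟨∑ j, c j • (biproduct.π (fun _ : Fin m => P) j)⟦n⟧', ?_⟩
  rw [Preadditive.sum_comp]
  refine Finset.sum_congr rfl fun j _ => ?_
  rw [Preadditive.comp_sum, Finset.sum_eq_single j]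
  · rw [Linear.comp_smul, Category.assoc, ← Functor.map_comp, biproduct.ι_π_self,
      CategoryTheory.Functor.map_id, Category.comp_id]
  · intro i _ hij
    rw [Linear.comp_smul, Category.assoc, ← Functor.map_comp, biproduct.ι_π_ne _ hij.symm,
      Functor.map_zero, comp_zero, smul_zero]
  · simp

lemma exists_right_approximation (P Z : C) [Module.Finite k (P ⟶ Z)] :
    ∃ (m : ℕ) (β : (⨁ (fun _ : Fin m => P)) ⟶ Z),
      ∀ f : P ⟶ Z, ∃ g : P ⟶ (⨁ (fun _ : Fin m => P)), f = g ≫ β := by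
  obtain ⟨m, b, hb⟩ := Module.Finite.exists_fin (R := k) (M := P ⟶ Z)
  refine ⟨m, biproduct.desc b, fun f => ?_⟩
  obtain ⟨c, rfl⟩ := (Submodule.mem_span_range_iff_exists_fun k).1
    (hb ▸ Submodule.mem_top : f ∈ Submodule.span k (Set.range b))
  exact ⟨biproduct.lift fun j => c j • 𝟙 P, by simp [biproduct.lift_desc]⟩

/-- The objects of the thick class generated by `P` without morphisms from `P` into their
positive shifts. -/
def aisle (P : C) : Set C := {Z | Z ∈ thickClosure {P} ∧ ∀ i : ℤ, 0 < i → HomVanish P Z i}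

section Silting

variable {k} {P : C} (hP : ∀ i : ℤ, 0 < i → HomVanish P P i)
  (hfin : ∀ W Z : C, W ∈ thickClosure {P} → Z ∈ thickClosure {P} → Module.Finite k (W ⟶ Z))
include hP hfin

lemma exists_triangle_of_mem_aisle {Z : C} (hZ : Z ∈ aisle P) :
    ∃ (Z' : C) (m : ℕ) (a : Z' ⟶ ⨁ (fun _ : Fin m => P)) (b : (⨁ (fun _ : Fin m => P)) ⟶ Z)
      (c : Z ⟶ Z'⟦(1 : ℤ)⟧), Z' ∈ aisle P ∧ Triangle.mk a b c ∈ distTriang C := by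
  have hPP : P ∈ thickClosure {P} := subset_thickClosure _ rfl
  have := hfin P Z hPP hZ.1
  obtain ⟨m, b, hb⟩ := exists_right_approximation k P Z
  obtain ⟨Z', a, c, hT⟩ := distinguished_cocone_triangle₁ b
  have hS := isThick_thickClosure {P}
  refine ⟨Z', m, a, b, c, ⟨hS.obj₁_mem _ hT (hS.biproduct_mem hPP m) hZ.1, fun i hi => ?_⟩, hT⟩
  obtain rfl | hi' : i = 1 ∨ 1 < i := by lia
  · intro f
    have h0 : f ≫ a⟦(1 : ℤ)⟧' = 0 := (hP 1 one_pos).biproduct_right _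
    obtain ⟨g, rfl⟩ := Triangle.coyoneda_exact₁ _ hT f h0
    obtain ⟨g', rfl⟩ := hb g
    have hz : b ≫ c = 0 := comp_distTriang_mor_zero₂₃ _ hT
    change (g' ≫ b) ≫ c = 0
    rw [Category.assoc, hz, comp_zero]
  · exact HomVanish.of_triangle_right₁ _ hT (m := i - 1) (by lia) (hP i hi).biproduct_right
      (hZ.2 (i - 1) (by lia))

lemma homVanish_of_mem_aisle {W : C} (hW : W ∈ thickClosure {P})
    (hWP : ∀ i : ℤ, 0 < i → HomVanish W P i) {Z : C} (hZ : Z ∈ aisle P) {i : ℤ} (hi : 0 < i) :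
    HomVanish W Z i := by
  obtain ⟨m, hm⟩ := exists_homVanish_of_mem_thickClosure hW (aisle P) fun Z hZ => hZ.2
  obtain ⟨l, hl⟩ : ∃ l : ℕ, m < i + l := ⟨(m - i).toNat + 1, by lia⟩
  induction l generalizing i Z with
  | zero => exact hm Z hZ i (by simpa using hl)
  | succ l ih =>
    obtain ⟨Z', n, a, b, c, hZ', hT⟩ := exists_triangle_of_mem_aisle hP hfin hZ
    exact HomVanish.of_triangle_right₃ _ hT rfl (hWP i hi).biproduct_right
      (ih hZ' (by lia) (by push_cast at hl; lia))

lemma mem_addOf_of_homVanish {W : C} (hW : W ∈ aisle P)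
    (hWP : ∀ i : ℤ, 0 < i → HomVanish W P i) : W ∈ addOf P := by
  obtain ⟨Z', m, a, b, c, hZ', hT⟩ := exists_triangle_of_mem_aisle hP hfin hW
  obtain ⟨s, hs⟩ := Triangle.coyoneda_exact₃ _ hT (𝟙 W)
    ((Category.id_comp _).trans (homVanish_of_mem_aisle hP hfin hW.1 hWP hZ' one_pos c))
  exact ⟨m, s, b, hs.symm⟩

lemma mem_starChain_of_homVanish (n : ℕ) {W : C} (hW : W ∈ aisle P)
    (hWP : ∀ i : ℤ, n < i → HomVanish W P i) :
    W ∈ starChain (fun i : ℕ => shiftSet (addOf P) (i : ℤ)) n := by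
  induction n generalizing W with
  | zero => exact ⟨W, mem_addOf_of_homVanish hP hfin hW (by simpa using hWP),
      ⟨((shiftFunctorZero C ℤ).app W).symm⟩⟩
  | succ n ih =>
    have hS := isThick_thickClosure {P}
    have hPP : P ∈ thickClosure {P} := subset_thickClosure _ rfl
    have := hfin W (P⟦((n + 1 : ℕ) : ℤ)⟧) hW.1 (hS.2.1 _ _ hPP)
    obtain ⟨m, α, hα⟩ := exists_left_approximation k W P ((n + 1 : ℕ) : ℤ)
    obtain ⟨W', a, c, hT⟩ := distinguished_cocone_triangle₁ α
    refine ⟨W', _, a, α, c, ih ⟨hS.obj₁_mem _ hT hW.1 (hS.2.1 _ _ (hS.biproduct_mem hPP m)),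
      fun i hi => ?_⟩ fun i hi => ?_, mem_shiftSet_biproduct P m _, hT⟩
    · exact HomVanish.of_triangle_right₁ _ hT (m := i - 1) (by lia) (hW.2 i hi)
        ((hP (n + i) (by lia)).biproduct_right.shift_right (by push_cast; lia))
    · obtain rfl | hi' : i = ((n + 1 : ℕ) : ℤ) ∨ ((n + 1 : ℕ) : ℤ) < i := by push_cast; lia
      · exact HomVanish.of_left_approximation _ hT rfl hα
          ((hP 1 one_pos).biproduct_left.shift_left (by lia))
      · exact HomVanish.of_triangle_left₁ _ hT rfl (hWP i hi')
          ((hP (i - n) (by lia)).biproduct_left.shift_left (by push_cast; lia))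

/-- Compare `mem_starChain_of_homVanish`: the last term of the chain can be taken in the
additive closure of a direct summand `T` of `P`, when there are no morphisms to the
complement. -/
lemma mem_star_addOf_of_homVanish {T Q X : C} {i : Q ⟶ P} {p : P ⟶ T} {h : T ⟶ Q⟦(1 : ℤ)⟧}
    (hT : Triangle.mk i p h ∈ distTriang C) (hTQ : HomVanish T Q 1) (d : ℕ)
    (hX : X ∈ aisle P) (hXP : ∀ i : ℤ, d + 1 < i → HomVanish X P i)
    (hXQ : HomVanish X Q (d + 1 : ℕ)) :
    X ∈ star (starChain (fun i : ℕ => shiftSet (addOf P) (i : ℤ)) d)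
      (shiftSet (addOf T) (d + 1 : ℕ)) := by
  have hS := isThick_thickClosure {P}
  have hPP : P ∈ thickClosure {P} := subset_thickClosure _ rfl
  obtain ⟨s, hs⟩ := Triangle.coyoneda_exact₃ _ hT (𝟙 T) ((Category.id_comp _).trans (hTQ h))
  have hTP : T ∈ thickClosure {P} := hS.2.2.2 _ _ s p hs.symm hPP
  have := hfin X (T⟦((d + 1 : ℕ) : ℤ)⟧) hX.1 (hS.2.1 _ _ hTP)
  obtain ⟨m, α, hα⟩ := exists_left_approximation k X T ((d + 1 : ℕ) : ℤ)
  obtain ⟨W, a, c, hW⟩ := distinguished_cocone_triangle₁ α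
  refine ⟨W, _, a, α, c, mem_starChain_of_homVanish hP hfin d
    ⟨hS.obj₁_mem _ hW hX.1 (hS.2.1 _ _ (hS.biproduct_mem hTP m)), fun i hi => ?_⟩ fun i hi => ?_,
    mem_shiftSet_biproduct T m _, hW⟩
  · exact HomVanish.of_triangle_right₁ _ hW (m := i - 1) (by lia) (hX.2 i hi)
      (((hP (d + i) (by lia)).of_retract_right s p hs.symm).biproduct_right.shift_right
        (by push_cast; lia))
  · have hTP : HomVanish ((⨁ (fun _ : Fin m => T))⟦((d + 1 : ℕ) : ℤ)⟧) P (i + 1) :=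
      ((hP (i - d) (by lia)).of_retract_left s p hs.symm).biproduct_left.shift_left
        (by push_cast; lia)
    obtain rfl | hi' : i = ((d + 1 : ℕ) : ℤ) ∨ ((d + 1 : ℕ) : ℤ) < i := by push_cast; lia
    · have hWQ : HomVanish W Q (d + 1 : ℕ) := HomVanish.of_triangle_left₁ _ hW rfl hXQ
        (hTQ.biproduct_left.shift_left (by lia))
      have hWT : HomVanish W T (d + 1 : ℕ) :=
        HomVanish.of_left_approximation _ hW rfl hα
          ((((hP 1 one_pos).of_retract_left s p hs.symm).of_retract_right s p
            hs.symm).biproduct_left.shift_left (by lia))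
      exact HomVanish.of_triangle_right _ hT hWQ hWT
    · exact HomVanish.of_triangle_left₁ _ hW rfl (hXP i (by push_cast at hi'; lia)) hTP

end Silting

end Abstract

section Replace

variable {C : Type u} [Category.{v} C] [HasZeroObject C] [Preadditive C] [HasShift C ℤ]
  [∀ n : ℤ, (shiftFunctor C n).Additive] [Pretriangulated C]
  {X Y Z : C} {f : X ⟶ Y} {g : Y ⟶ Z} {h : Z ⟶ X⟦(1 : ℤ)⟧}

lemma distinguished_of_iso₁ (hT : Triangle.mk f g h ∈ distTriang C) {X' : C} (e : X ≅ X') :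
    Triangle.mk (e.inv ≫ f) g (h ≫ e.hom⟦(1 : ℤ)⟧') ∈ distTriang C := by
  refine isomorphic_distinguished _ hT _
    (Triangle.isoMk _ _ e.symm (Iso.refl Y) (Iso.refl Z) ?_ ?_ ?_)
  · change (e.inv ≫ f) ≫ 𝟙 Y = e.inv ≫ f
    simp
  · change g ≫ 𝟙 Z = 𝟙 Y ≫ g
    simp
  · change (h ≫ e.hom⟦(1 : ℤ)⟧') ≫ e.inv⟦(1 : ℤ)⟧' = 𝟙 Z ≫ h
    simp [← Functor.map_comp]

lemma distinguished_of_iso₃ (hT : Triangle.mk f g h ∈ distTriang C) {Z' : C} (e : Z ≅ Z') :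
    Triangle.mk f (g ≫ e.hom) (e.inv ≫ h) ∈ distTriang C := by
  refine isomorphic_distinguished _ hT _
    (Triangle.isoMk _ _ (Iso.refl X) (Iso.refl Y) e.symm ?_ ?_ ?_)
  · change f ≫ 𝟙 Y = 𝟙 X ≫ f
    simp
  · change (g ≫ e.hom) ≫ e.inv = 𝟙 Y ≫ g
    simp
  · change (e.inv ≫ h) ≫ (𝟙 X)⟦(1 : ℤ)⟧' = e.inv ≫ h
    simp

end Replace
section Derived

open DerivedCategory

section Amplitude

variable {C : Type u} [Category.{v} C] [Abelian C] [HasDerivedCategory.{w} C]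

/-- A bounded above complex of projectives, zero in degrees `< a`, has no nonzero morphisms
to objects whose cohomology is concentrated in degrees `< a`. -/
lemma hom_eq_zero_of_projective (K : CochainComplex C ℤ) (a b : ℤ)
    [∀ i, Projective (K.X i)] [K.IsStrictlyLE b] [K.IsStrictlyGE a]
    (Y : DerivedCategory C) (n : ℤ) (hn : n < a) [Y.IsLE n] (f : Q.obj K ⟶ Y) : f = 0 := by
  obtain ⟨L, _, ⟨e⟩⟩ := Y.exists_iso_Q_obj_of_isLE n
  have := CochainComplex.isKProjective_of_projective K b
  rw [← cancel_mono e.hom, zero_comp]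
  obtain ⟨g, hg⟩ := (CochainComplex.IsKProjective.Qh_map_bijective K
    ((HomotopyCategory.quotient C _).obj L)).surjective
    ((quotientCompQhIso C).hom.app K ≫ (f ≫ e.hom) ≫ (quotientCompQhIso C).inv.app L)
  obtain ⟨g, rfl⟩ := (HomotopyCategory.quotient C _).map_surjective g
  have hg0 : g = 0 := by
    ext i
    by_cases hi : i < a
    · exact (K.isZero_of_isStrictlyGE a i hi).eq_of_src _ _
    · exact (L.isZero_of_isStrictlyLE n i (by lia)).eq_of_tgt _ _
  rw [hg0] at hg
  simpa [-NatTrans.naturality] using hg.symm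

lemma singleFunctor_hom_eq_zero_of_projective (F : C) [Projective F] (Y : DerivedCategory C) (n : ℤ) (hn : n < 0)
    [Y.IsLE n] (f : (singleFunctor C 0).obj F ⟶ Y) : f = 0 := by
  have (i : ℤ) : Projective (((HomologicalComplex.single C (.up ℤ) 0).obj F).X i) := by
    by_cases hi : i = 0
    · subst hi
      exact Projective.of_iso (HomologicalComplex.singleObjXSelf (.up ℤ) 0 F).symm inferInstance
    · exact Projective.of_iso
        (HomologicalComplex.isZero_single_obj_X (.up ℤ) 0 F i hi).isoZero.symm inferInstance
  have := CochainComplex.isKProjective_of_projective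
      ((HomologicalComplex.single C (.up ℤ) 0).obj F) 0
  exact hom_eq_zero_of_projective ((HomologicalComplex.single C (.up ℤ) 0).obj F) 0 0 Y n hn f

end Amplitude

section PD

variable {R : Type} [Ring R] [HasDerivedCategory.{w} (ModuleCat.{0} R)]

omit [HasDerivedCategory.{w} (ModuleCat.{0} R)] in
lemma shortExact_kernel {M P : ModuleCat.{0} R} (f : P ⟶ M) [Epi f] :
    (ShortComplex.mk (kernel.ι f) f (kernel.condition f)).ShortExact :=
  { exact := ShortComplex.exact_of_f_is_kernel _ (kernelIsKernel f)
    mono_f := inferInstanceAs (Mono (kernel.ι f))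
    epi_g := inferInstanceAs (Epi f) }

lemma hom_eq_zero_of_pdLE {n : ℕ} {M : ModuleCat.{0} R} (hM : pdLE R n M)
    (Y : DerivedCategory (ModuleCat.{0} R)) (m : ℤ) (hm : m < -n) [Y.IsLE m]
    (f : (singleFunctor _ 0).obj M ⟶ Y) : f = 0 := by
  induction n generalizing M Y m with
  | zero =>
    have : Projective M := hM
    exact singleFunctor_hom_eq_zero_of_projective M Y m (by simpa using hm) f
  | succ n ih =>
    obtain ⟨P, g, _, _, hK⟩ := hM
    have : (Y⟦(-1 : ℤ)⟧).IsLE (m + 1) := TStructure.t.isLE_shift Y m (-1) (m + 1) (by lia)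
    have h₁ : HomVanish ((singleFunctor _ 0).obj (kernel g)) Y (-1) := fun u =>
      ih hK _ (m + 1) (by push_cast at hm; lia) u
    have h₂ : HomVanish ((singleFunctor _ 0).obj P) (Y⟦(0 : ℤ)⟧) 0 := fun u =>
      have : ((Y⟦(0 : ℤ)⟧)⟦(0 : ℤ)⟧).IsLE m := by
        have := TStructure.t.isLE_shift Y m 0 m (by lia)
        exact TStructure.t.isLE_shift _ m 0 m (by lia)
      singleFunctor_hom_eq_zero_of_projective P _ m (by push_cast at hm; lia) u
    have h₂ : HomVanish ((singleFunctor _ 0).obj P) Y 0 :=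
      h₂.of_iso_right ((shiftFunctorZero _ ℤ).app Y).symm
    have h₃ := HomVanish.of_triangle_left₃ (n := 0) (Y := Y) _ (shortExact_kernel g).singleTriangle_distinguished
      (by lia) h₂ h₁
    rw [← cancel_mono ((shiftFunctorZero _ ℤ).app Y).inv, zero_comp]
    exact h₃ _

omit [HasDerivedCategory.{w} (ModuleCat.{0} R)] in
lemma hasProjectiveDimensionLT_of_pdLE {n : ℕ} {M : ModuleCat.{0} R} (hM : pdLE R n M) :
    HasProjectiveDimensionLT M (n + 1) := by
  induction n generalizing M with
  | zero => exact (projective_iff_hasProjectiveDimensionLT_one).1 hM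
  | succ n ih =>
    obtain ⟨P, g, _, _, hK⟩ := hM
    have := ih hK
    exact (shortExact_kernel g).hasProjectiveDimensionLT_X₃ (n + 1) this inferInstance

/-- A class of objects of the derived category closed under cones and containing finitely
generated projectives contains finitely generated modules of finite projective dimension. -/
lemma singleFunctor_obj_mem_of_hasProjectiveDimensionLT [IsNoetherianRing R]
    {S : Set (DerivedCategory (ModuleCat.{0} R))} (hS : IsThick S)
    (hproj : ∀ F : ModuleCat.{0} R, Projective F → Module.Finite R F →
      (singleFunctor _ 0).obj F ∈ S) (n : ℕ) (M : ModuleCat.{0} R) [Module.Finite R M]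
    [hM : HasProjectiveDimensionLT M (n + 1)] : (singleFunctor _ 0).obj M ∈ S := by
  induction n generalizing M with
  | zero => exact hproj M ((projective_iff_hasProjectiveDimensionLT_one).2 hM) inferInstance
  | succ n ih =>
    obtain ⟨m, g, hg⟩ := Module.Finite.exists_fin' R M
    let g' : ModuleCat.of R (Fin m → R) ⟶ M := ModuleCat.ofHom g
    have : Epi g' := (ModuleCat.epi_iff_surjective g').2 hg
    have hF : Projective (ModuleCat.of R (Fin m → R)) := inferInstance
    have hK : Module.Finite R (kernel g' : ModuleCat R) :=
      Module.Finite.of_injective (kernel.ι g').hom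
        ((ModuleCat.mono_iff_injective _).1 inferInstance)
    have := (shortExact_kernel g').hasProjectiveDimensionLT_X₁ (n + 1) inferInstance hM
    exact hS.obj₃_mem _ (shortExact_kernel g').singleTriangle_distinguished (ih _)
      (hproj _ hF inferInstance)

end PD

section Truncation

variable {C : Type u} [Category.{v} C] [Abelian C] [HasDerivedCategory.{w} C]

lemma nonempty_iso_singleFunctor_homology (X : DerivedCategory C) (n : ℤ) [X.IsGE n] [X.IsLE n] :
    Nonempty (X ≅ (singleFunctor C n).obj ((homologyFunctor C n).obj X)) := by
  obtain ⟨M, ⟨e⟩⟩ := X.exists_iso_singleFunctor_obj_of_isGE_of_isLE n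
  exact ⟨e ≪≫ (singleFunctor C n).mapIso (((singleFunctorCompHomologyFunctorIso C n).app M).symm ≪≫
    (homologyFunctor C n).mapIso e.symm)⟩

/-- The triangle splitting off the lowest cohomology object. -/
lemma exists_triangle_of_isGE (X : DerivedCategory C) (a : ℤ) [X.IsGE a] :
    ∃ (X' : DerivedCategory C) (f : (singleFunctor C a).obj ((homologyFunctor C a).obj X) ⟶ X)
      (g : X ⟶ X') (h : X' ⟶ ((singleFunctor C a).obj ((homologyFunctor C a).obj X))⟦(1 : ℤ)⟧),
      Triangle.mk f g h ∈ distTriang _ ∧ X'.IsGE (a + 1) ∧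
      ∀ i, a + 1 ≤ i → IsIso ((homologyFunctor C i).map g) := by
  obtain ⟨Y, X', hY, hX', f, g, h, hT⟩ := TStructure.t.exists_triangle X a (a + 1) rfl
  have hYLE : Y.IsLE a := ⟨hY⟩
  have hX'GE : X'.IsGE (a + 1) := ⟨hX'⟩
  have hYGE : Y.IsGE a := by
    rw [isGE_iff]
    intro i hi
    exact (HomologySequence.exact₁ _ hT (i - 1) i (by lia)).isZero_of_both_zeros
      ((X'.isZero_of_isGE (a + 1) (i - 1) (by lia)).eq_of_src _ _)
      ((X.isZero_of_isGE a i hi).eq_of_tgt _ _)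
  have h₁ : Mono ((homologyFunctor C a).map f) :=
    (HomologySequence.mono_homologyMap_mor₁_iff _ hT (a - 1) a (by lia)).2
      ((X'.isZero_of_isGE (a + 1) (a - 1) (by lia)).eq_of_src _ _)
  have h₂ : Epi ((homologyFunctor C a).map f) :=
    (HomologySequence.epi_homologyMap_mor₁_iff _ hT a).2
      ((X'.isZero_of_isGE (a + 1) a (by lia)).eq_of_tgt _ _)
  have h₃ : IsIso ((homologyFunctor C a).map f) := isIso_of_mono_of_epi _
  obtain ⟨e⟩ := nonempty_iso_singleFunctor_homology Y a
  let e' := e ≪≫ (singleFunctor C a).mapIso (asIso ((homologyFunctor C a).map f))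
  refine ⟨X', e'.inv ≫ f, g, h ≫ e'.hom⟦1⟧', distinguished_of_iso₁ hT e', hX'GE, ?_⟩
  · intro i hi
    have : Mono ((homologyFunctor C i).map g) :=
      (HomologySequence.mono_homologyMap_mor₂_iff _ hT i).2
        ((Y.isZero_of_isLE a i (by lia)).eq_of_src _ _)
    have : Epi ((homologyFunctor C i).map g) :=
      (HomologySequence.epi_homologyMap_mor₂_iff _ hT i (i + 1) rfl).2
        ((Y.isZero_of_isLE a (i + 1) (by lia)).eq_of_tgt _ _)
    exact isIso_of_mono_of_epi _

end Truncation

section Bounded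

variable {R : Type} [Ring R] [HasDerivedCategory.{w} (ModuleCat.{0} R)]

lemma mem_of_isGE_of_isLE {S : Set (DerivedCategory (ModuleCat.{0} R))}
    (hiso : ∀ ⦃X Y⦄, (X ≅ Y) → X ∈ S → Y ∈ S)
    (hext : ∀ T ∈ distTriang (DerivedCategory (ModuleCat.{0} R)),
      T.obj₁ ∈ S → T.obj₃ ∈ S → T.obj₂ ∈ S)
    (n : ℕ) (a : ℤ)
    (hsingle : ∀ i, a ≤ i → ∀ M : ModuleCat.{0} R, Module.Finite R M →
      (singleFunctor _ i).obj M ∈ S)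
    (X : DerivedCategory (ModuleCat.{0} R)) [X.IsGE a] [X.IsLE (a + n)]
    (hfin : ∀ i, Module.Finite R ((homologyFunctor (ModuleCat.{0} R) i).obj X)) : X ∈ S := by
  induction n generalizing a X with
  | zero =>
    have : X.IsLE a := TStructure.t.isLE_of_le X (a + (0 : ℕ)) a (by simp)
    obtain ⟨e⟩ := nonempty_iso_singleFunctor_homology X a
    exact hiso e.symm (hsingle a le_rfl _ (hfin a))
  | succ n ih =>
    obtain ⟨X', f, g, h, hT, hGE, hX'⟩ := exists_triangle_of_isGE X a
    have hLE : X'.IsLE (a + 1 + n) := by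
      rw [isLE_iff]
      intro i hi
      have := hX' i (by lia)
      exact (X.isZero_of_isLE (a + (n + 1 : ℕ)) i (by push_cast; lia)).of_iso
        (asIso ((homologyFunctor _ i).map g)).symm
    refine hext _ hT (hsingle a le_rfl _ (hfin a))
      (ih (a + 1) (fun i hi => hsingle i (by lia)) X' fun i => ?_)
    by_cases hi : a + 1 ≤ i
    · have := hX' i hi
      have := hfin i
      exact Module.Finite.equiv (asIso ((homologyFunctor _ i).map g)).toLinearEquiv
    · have := ModuleCat.subsingleton_of_isZero (X'.isZero_of_isGE (a + 1) i (by lia))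
      infer_instance

lemma InDb.mem {X : DerivedCategory (ModuleCat.{0} R)} (hX : InDb R X)
    {S : Set (DerivedCategory (ModuleCat.{0} R))}
    (hiso : ∀ ⦃X Y⦄, (X ≅ Y) → X ∈ S → Y ∈ S)
    (hext : ∀ T ∈ distTriang (DerivedCategory (ModuleCat.{0} R)),
      T.obj₁ ∈ S → T.obj₃ ∈ S → T.obj₂ ∈ S)
    (a : ℤ) [X.IsGE a]
    (hsingle : ∀ i, a ≤ i → ∀ M : ModuleCat.{0} R, Module.Finite R M →
      (singleFunctor _ i).obj M ∈ S) : X ∈ S := by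
  obtain ⟨⟨_, b, hb⟩, hfin⟩ := hX
  have : X.IsLE (a + (b - a).toNat) := by
    rw [isLE_iff]
    exact fun i hi => hb i (Or.inr (by lia))
  exact mem_of_isGE_of_isLE hiso hext (b - a).toNat a hsingle X hfin

lemma InDb.exists_isGE {X : DerivedCategory (ModuleCat.{0} R)} (hX : InDb R X) :
    ∃ a : ℤ, X.IsGE a := by
  obtain ⟨⟨a, _, ha⟩, _⟩ := hX
  exact ⟨a, (isGE_iff _ _).2 fun i hi => ha i (Or.inl hi)⟩

/-- The object `M` in degree `n` is the shift of `M` in degree `0` by `-n`. -/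
def singleFunctorObjIso (M : ModuleCat.{0} R) (n : ℤ) :
    (singleFunctor _ n).obj M ≅ ((singleFunctor _ 0).obj M)⟦-n⟧ :=
  (((singleFunctors _).shiftIso (-n) n 0 (by lia)).app M).symm

lemma InDb.mem_of_isThick [IsNoetherianRing R] {d : ℕ} (hgld : gldLE.{0, 0} R d)
    {X : DerivedCategory (ModuleCat.{0} R)} (hX : InDb R X)
    {S : Set (DerivedCategory (ModuleCat.{0} R))} (hS : IsThick S)
    (hproj : ∀ F : ModuleCat.{0} R, Projective F → Module.Finite R F →
      (singleFunctor _ 0).obj F ∈ S) : X ∈ S := by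
  obtain ⟨a, _⟩ := hX.exists_isGE
  refine hX.mem hS.1 hS.2.2.1 a fun i _ M hM =>
    hS.1 (singleFunctorObjIso M i).symm (hS.2.1 _ _ ?_)
  have := hasProjectiveDimensionLT_of_pdLE (hgld M hM)
  exact singleFunctor_obj_mem_of_hasProjectiveDimensionLT hS hproj d M

lemma InDb.hom_eq_zero {d : ℕ} (hgld : gldLE.{0, 0} R d)
    {X : DerivedCategory (ModuleCat.{0} R)} (hX : InDb R X) (a : ℤ) [X.IsGE a]
    (Y : DerivedCategory (ModuleCat.{0} R)) (m : ℤ) (hm : m < a - d) [Y.IsLE m] 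
    (f : X ⟶ Y) : f = 0 := by
  refine hX.mem (S := {X | ∀ f : X ⟶ Y, f = 0}) ?_ ?_ a ?_ f
  · intro X X' e h f
    rw [← cancel_epi e.hom, comp_zero, h (e.hom ≫ f)]
  · intro T hT h₁ h₃ f
    obtain ⟨g, rfl⟩ := T.yoneda_exact₂ hT f (h₁ _)
    rw [h₃ g, comp_zero]
  · intro i hi M hM f
    have := TStructure.t.isLE_shift Y m i (m - i) (by lia)
    have h : HomVanish ((singleFunctor _ 0).obj M) Y i :=
      hom_eq_zero_of_pdLE (hgld M hM) _ (m - i) (by lia)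
    have h' := (h.shift_left (a := -i) (n := 0) (by lia)).of_iso_left (singleFunctorObjIso M i)
    rw [← cancel_mono ((shiftFunctorZero _ ℤ).app Y).inv, zero_comp]
    exact h' _

end Bounded

section FiniteHom

section Linear

variable (k : Type*) [Field k]

lemma finite_of_exact {V₁ V₂ V₃ : Type*} [AddCommGroup V₁] [AddCommGroup V₂]
    [AddCommGroup V₃] [Module k V₁] [Module k V₂] [Module k V₃] [Module.Finite k V₁]
    [Module.Finite k V₃] (f : V₁ →ₗ[k] V₂) (g : V₂ →ₗ[k] V₃)
    (hfg : ∀ x, g x = 0 → ∃ y, f y = x) : Module.Finite k V₂ := by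
  have : Module.Finite k (LinearMap.ker g) :=
    Module.Finite.of_surjective (LinearMap.codRestrict (LinearMap.ker g)
      (f.domRestrict (LinearMap.ker (g ∘ₗ f))) fun x => x.2) <| by
      rintro ⟨x, hx⟩
      obtain ⟨y, rfl⟩ := hfg x hx
      exact ⟨⟨y, hx⟩, rfl⟩
  have : Module.Finite k (V₂ ⧸ LinearMap.ker g) :=
    Module.Finite.equiv g.quotKerEquivRange.symm
  exact Module.Finite.of_submodule_quotient (LinearMap.ker g)

variable {C : Type u} [Category.{v} C] [HasZeroObject C] [Preadditive C] [HasShift C ℤ]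
  [∀ n : ℤ, (shiftFunctor C n).Additive] [Pretriangulated C] [Linear k C]
  [∀ n : ℤ, (shiftFunctor C n).Linear k]

omit [HasZeroObject C] [HasShift C ℤ] [∀ n : ℤ, (shiftFunctor C n).Additive]
  [Pretriangulated C] [∀ n : ℤ, (shiftFunctor C n).Linear k] in
lemma finite_hom_of_retract {X X' Y Y' : C} (h : Module.Finite k (X ⟶ Y))
    (s : X' ⟶ X) (r : X ⟶ X') (hsr : s ≫ r = 𝟙 X')
    (s' : Y' ⟶ Y) (r' : Y ⟶ Y') (hsr' : s' ≫ r' = 𝟙 Y') : Module.Finite k (X' ⟶ Y') :=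
  Module.Finite.of_surjective (Linear.leftComp k Y' s ∘ₗ Linear.rightComp k X r') fun f =>
    ⟨r ≫ f ≫ s', by simp [reassoc_of% hsr, hsr']⟩

lemma isThick_finite_hom_left (Y : C) :
    IsThick {W : C | ∀ i : ℤ, Module.Finite k (W ⟶ Y⟦i⟧)} := by
  refine ⟨fun X X' e h i => finite_hom_of_retract k (h i) e.inv e.hom e.inv_hom_id (𝟙 _) (𝟙 _)
    (Category.id_comp _), fun X n h i => ?_, fun T hT h₁ h₃ i => ?_,
    fun X X' s r hsr h i => finite_hom_of_retract k (h i) s r hsr (𝟙 _) (𝟙 _)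
    (Category.id_comp _)⟩
  · have := h (i - n)
    let e := (shiftFunctorAdd' C (i - n) n i (by lia)).app Y
    refine Module.Finite.of_surjective (Linear.rightComp k _ e.inv ∘ₗ
      (shiftFunctor C n).mapLinearMap k (X := X) (Y := Y⟦i - n⟧)) fun f => ?_
    obtain ⟨g, hg⟩ := (shiftFunctor C n).map_surjective (f ≫ e.hom)
    exact ⟨g, by change (shiftFunctor C n).map g ≫ e.inv = f; rw [hg, Category.assoc, e.hom_inv_id, Category.comp_id]⟩
  · have := h₁ i
    have := h₃ i
    refine finite_of_exact k (Linear.leftComp k (Y⟦i⟧) T.mor₂) (Linear.leftComp k (Y⟦i⟧) T.mor₁)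
      fun f hf => ?_
    obtain ⟨g, hg⟩ := T.yoneda_exact₂ hT f hf
    exact ⟨g, hg.symm⟩

omit [∀ n : ℤ, (shiftFunctor C n).Linear k] in
lemma isThick_finite_hom_right (X : C) :
    IsThick {Z : C | ∀ i : ℤ, Module.Finite k (X ⟶ Z⟦i⟧)} := by
  have retract (Y Y' : C) (s : Y' ⟶ Y) (r : Y ⟶ Y') (hsr : s ≫ r = 𝟙 Y')
      (h : ∀ i : ℤ, Module.Finite k (X ⟶ Y⟦i⟧)) (i : ℤ) : Module.Finite k (X ⟶ Y'⟦i⟧) :=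
    finite_hom_of_retract k (h i) (𝟙 _) (𝟙 _) (Category.id_comp _) (s⟦i⟧') (r⟦i⟧')
      (by rw [← Functor.map_comp, hsr, CategoryTheory.Functor.map_id])
  refine ⟨fun Y Y' e h => retract Y Y' e.inv e.hom e.inv_hom_id h, fun Y n h i => ?_,
    fun T hT h₁ h₃ i => ?_, fun Y' Y s r hsr h => retract Y Y' s r hsr h⟩
  · let e := (shiftFunctorAdd C n i).app Y
    exact finite_hom_of_retract k (h (n + i)) (𝟙 _) (𝟙 _) (Category.id_comp _) e.inv e.hom
      e.inv_hom_id
  · have := h₁ i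
    have := h₃ i
    have hT' := T.shift_distinguished hT i
    let T' := (Triangle.shiftFunctor C i).obj T
    have : Module.Finite k (X ⟶ T'.obj₁) := h₁ i
    have : Module.Finite k (X ⟶ T'.obj₃) := h₃ i
    exact finite_of_exact k (V₂ := X ⟶ T'.obj₂) (Linear.rightComp k X T'.mor₁)
      (Linear.rightComp k X T'.mor₂) fun f hf => by
        obtain ⟨g, hg⟩ := Triangle.coyoneda_exact₂ _ hT' f hf
        exact ⟨g, hg.symm⟩

lemma finite_hom_of_mem_thickClosure {G : Set C}
    (hG : ∀ X ∈ G, ∀ Y ∈ G, ∀ i : ℤ, Module.Finite k (X ⟶ Y⟦i⟧)) {X Y : C}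
    (hX : X ∈ thickClosure G) (hY : Y ∈ thickClosure G) : Module.Finite k (X ⟶ Y) := by
  have h : ∀ i : ℤ, Module.Finite k (X ⟶ Y⟦i⟧) :=
    hX _ (isThick_finite_hom_left k Y) fun X hX =>
      hY _ (isThick_finite_hom_right k X) fun Y hY => hG X hX Y hY
  let e := (shiftFunctorZero C ℤ).app Y
  exact finite_hom_of_retract k (h 0) (𝟙 _) (𝟙 _) (Category.id_comp _) e.inv e.hom
      e.inv_hom_id

end Linear

variable (k : Type) {R : Type} [Field k] [Ring R] [Algebra k R] [Module.Finite k R]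

open scoped ModuleCat in
lemma finite_hom_moduleCat (M N : ModuleCat.{0} R) [Module.Finite R M] [Module.Finite R N] :
    Module.Finite k (M ⟶ N) := by
  have : Module.Finite k M := Module.Finite.trans R M
  have : Module.Finite k N := Module.Finite.trans R N
  let φ : (M ⟶ N) →ₗ[k] (M →ₗ[k] N) :=
    { toFun f := f.hom.restrictScalars k
      map_add' _ _ := rfl
      map_smul' _ _ := rfl }
  refine Module.Finite.of_injective φ fun f g h => ?_
  ext x
  exact DFunLike.congr_fun h x

variable [HasDerivedCategory.{w} (ModuleCat.{0} R)]

lemma finite_hom_singleFunctor (F F' : ModuleCat.{0} R) [Projective F] [Module.Finite R F]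
    [Module.Finite R F'] (i : ℤ) :
    Module.Finite k ((singleFunctor _ 0).obj F ⟶ ((singleFunctor _ 0).obj F')⟦i⟧) := by
  obtain hi | rfl | hi := lt_trichotomy i 0
  · have := TStructure.t.isGE_shift ((singleFunctor _ 0).obj F') 0 i (-i) (by lia)
    have : Subsingleton ((singleFunctor _ 0).obj F ⟶ ((singleFunctor _ 0).obj F')⟦i⟧) :=
      subsingleton_of_forall_eq 0 fun f => TStructure.t.zero f 0 (-i) (by lia)
    infer_instance
  · have := finite_hom_moduleCat k F F'
    let e := (shiftFunctorZero _ ℤ).app ((singleFunctor _ 0).obj F')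
    refine Module.Finite.of_surjective (Linear.rightComp k _ e.inv ∘ₗ
      (singleFunctor _ 0).mapLinearMap k (X := F) (Y := F')) fun f => ?_
    obtain ⟨g, hg⟩ := (singleFunctor _ 0).map_surjective (f ≫ e.hom)
    exact ⟨g, by change (singleFunctor _ 0).map g ≫ e.inv = f; rw [hg, Category.assoc, e.hom_inv_id, Category.comp_id]⟩
  · have := TStructure.t.isLE_shift ((singleFunctor _ 0).obj F') 0 i (-i) (by lia)
    have : Subsingleton ((singleFunctor _ 0).obj F ⟶ ((singleFunctor _ 0).obj F')⟦i⟧) :=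
      subsingleton_of_forall_eq 0 fun f => singleFunctor_hom_eq_zero_of_projective F _ (-i) (by lia) f
    infer_instance

end FiniteHom

section TwoTerm

variable {R : Type} [Ring R] {P : CochainComplex (ModuleCat.{0} R) ℤ}

lemma IsTwoTermCplx.isStrictlyLE (hP : IsTwoTermCplx R P) : P.IsStrictlyLE 0 :=
  (CochainComplex.isStrictlyLE_iff _ _).2 fun i hi => hP.2.2 i (by lia) (by lia)

lemma IsTwoTermCplx.isStrictlyGE (hP : IsTwoTermCplx R P) : P.IsStrictlyGE (-1) :=
  (CochainComplex.isStrictlyGE_iff _ _).2 fun i hi => hP.2.2 i (by lia) (by lia)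

lemma finite_homology [IsNoetherianRing R] (K : CochainComplex (ModuleCat.{0} R) ℤ)
    (i : ℤ) [Module.Finite R (K.X i)] : Module.Finite R (K.homology i) :=
  have : Module.Finite R (K.cycles i) :=
    Module.Finite.of_injective (K.iCycles i).hom ((ModuleCat.mono_iff_injective _).1 inferInstance)
  Module.Finite.of_surjective (K.homologyπ i).hom
    ((ModuleCat.epi_iff_surjective _).1 inferInstance)

variable [HasDerivedCategory.{w} (ModuleCat.{0} R)]

lemma IsTwoTermCplx.hom_eq_zero (hP : IsTwoTermCplx R P) (Y : DerivedCategory (ModuleCat.{0} R))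
    (n : ℤ) (hn : n < -1) [Y.IsLE n] (f : Q.obj P ⟶ Y) : f = 0 := by
  have := hP.1
  have := hP.isStrictlyLE
  have := hP.isStrictlyGE
  exact hom_eq_zero_of_projective P (-1) 0 Y n hn f

lemma IsTwoTermCplx.isLE (hP : IsTwoTermCplx R P) : (Q.obj P).IsLE 0 := by
  have := hP.isStrictlyLE
  infer_instance

lemma IsTwoTermCplx.inDb [IsNoetherianRing R] (hP : IsTwoTermCplx R P) : InDb R (Q.obj P) := by
  have := hP.isStrictlyLE
  have := hP.isStrictlyGE
  refine ⟨⟨-1, 0, fun i hi => ?_⟩, fun i => ?_⟩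
  · rcases hi with hi | hi
    · exact (Q.obj P).isZero_of_isGE (-1) i hi
    · exact (Q.obj P).isZero_of_isLE 0 i hi
  · have := hP.2.1 i
    have : Module.Finite R ((HomologicalComplex.homologyFunctor (ModuleCat.{0} R) _ i).obj P) :=
      finite_homology P i
    exact Module.Finite.equiv ((homologyFunctorFactors _ i).app P).symm.toLinearEquiv

omit [HasDerivedCategory.{w} (ModuleCat.{0} R)] in
lemma isPerfCplx_single (F : ModuleCat.{0} R) [Projective F] [Module.Finite R F] :
    IsPerfCplx R ((HomologicalComplex.single (ModuleCat.{0} R) (.up ℤ) 0).obj F) := by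
  refine ⟨fun i => ?_, fun i => ?_, 0, 0, fun i hi =>
    HomologicalComplex.isZero_single_obj_X (.up ℤ) 0 F i (by lia)⟩
  all_goals
    by_cases hi : i = 0
    · subst hi
      first
      | exact Projective.of_iso (HomologicalComplex.singleObjXSelf (.up ℤ) 0 F).symm inferInstance
      | exact Module.Finite.equiv
          (HomologicalComplex.singleObjXSelf (.up ℤ) 0 F).symm.toLinearEquiv
    · have h := HomologicalComplex.isZero_single_obj_X (.up ℤ) 0 F i hi
      first
      | exact Projective.of_iso h.isoZero.symm inferInstance
      | have := ModuleCat.subsingleton_of_isZero h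
        infer_instance

namespace IsTwoTermSilting

variable (hP : IsTwoTermSilting R P)
include hP

lemma homVanish (i : ℤ) (hi : 0 < i) : HomVanish (Q.obj P) (Q.obj P) i := by
  obtain rfl | hi : i = 1 ∨ 1 < i := by lia
  · exact hP.2.1
  · have := hP.1.isLE
    have := TStructure.t.isLE_shift (Q.obj P) 0 i (-i) (by lia)
    exact hP.1.hom_eq_zero _ (-i) (by lia)

lemma single_mem (F : ModuleCat.{0} R) [Projective F] [Module.Finite R F] :
    (singleFunctor _ 0).obj F ∈ thickClosure {Q.obj P} := fun S hS hPS =>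
  hP.2.2 S hS (hPS rfl) _ (isPerfCplx_single F)

variable [IsNoetherianRing R] {d : ℕ} (hgld : gldLE.{0, 0} R d)
include hgld

lemma mem_thickClosure {X : DerivedCategory (ModuleCat.{0} R)} (hX : InDb R X) :
    X ∈ thickClosure {Q.obj P} :=
  hX.mem_of_isThick hgld (isThick_thickClosure _) fun F _ _ => hP.single_mem F

lemma finite_hom (k : Type) [Field k] [Algebra k R] [Module.Finite k R]
    (W Z : DerivedCategory (ModuleCat.{0} R)) (hW : W ∈ thickClosure {Q.obj P})
    (hZ : Z ∈ thickClosure {Q.obj P}) : Module.Finite k (W ⟶ Z) := by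
  let G : Set (DerivedCategory (ModuleCat.{0} R)) :=
    {X | ∃ F : ModuleCat.{0} R, Projective F ∧ Module.Finite R F ∧ X = (singleFunctor _ 0).obj F}
  have hG : {Q.obj P} ⊆ thickClosure G := Set.singleton_subset_iff.2 <|
    hP.1.inDb.mem_of_isThick hgld (isThick_thickClosure G) fun F h h' =>
      subset_thickClosure G ⟨F, h, h', rfl⟩
  refine finite_hom_of_mem_thickClosure k (G := G) ?_ (hW _ (isThick_thickClosure G) hG)
    (hZ _ (isThick_thickClosure G) hG)
  rintro _ ⟨F, _, _, rfl⟩ _ ⟨F', _, _, rfl⟩ i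
  exact finite_hom_singleFunctor k F F' i

lemma mem_aisle {X : DerivedCategory (ModuleCat.{0} R)} (hX : X ∈ CP P) :
    X ∈ aisle (Q.obj P) :=
  ⟨hP.mem_thickClosure hgld hX.1, fun i hi => hX.2 i hi.ne'⟩

/-- Objects of the heart of a two-term silting complex have no cohomology in degrees `< -1`. -/
lemma isGE_of_mem_CP (k : Type) [Field k] [Algebra k R] [Module.Finite k R]
    {X : DerivedCategory (ModuleCat.{0} R)} (hX : X ∈ CP P) : X.IsGE (-1) := by
  let A : DerivedCategory (ModuleCat.{0} R) := (singleFunctor _ 0).obj (ModuleCat.of R R)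
  have hA : A⟦(1 : ℤ)⟧ ∈ aisle (Q.obj P) := by
    refine ⟨(isThick_thickClosure _).2.1 _ _ (hP.single_mem _), fun i hi f => ?_⟩
    have := TStructure.t.isLE_shift A 0 1 (-1) (by lia)
    have := TStructure.t.isLE_shift (A⟦(1 : ℤ)⟧) (-1) i (-1 - i) (by lia)
    exact hP.1.hom_eq_zero _ (-1 - i) (by lia) f
  have hA' : ∀ i : ℤ, (1 : ℕ) < i → HomVanish (A⟦(1 : ℤ)⟧) (Q.obj P) i := fun i hi => by
    refine HomVanish.shift_left (m := i - 1) (fun f => ?_) (by lia)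
    have := hP.1.isLE
    have := TStructure.t.isLE_shift (Q.obj P) 0 (i - 1) (1 - i) (by lia)
    exact singleFunctor_hom_eq_zero_of_projective _ _ (1 - i) (by push_cast at hi; lia) f
  obtain ⟨U, V, f, g, h, ⟨U', hU', ⟨eU⟩⟩, ⟨V', hV', ⟨eV⟩⟩, hT⟩ :=
    mem_starChain_of_homVanish (k := k) hP.homVanish (hP.finite_hom hgld k) 1 hA hA'
  have hAX (i : ℤ) (hi : i < -1) : HomVanish A X i := by
    have h₀ (j : ℤ) (hj : j < 0) : HomVanish (A⟦(1 : ℤ)⟧) X j := by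
      have hU : HomVanish U X j := ((HomVanish.left_of_mem_addOf (hX.2 j hj.ne) hU').shift_left
        (by simp)).of_iso_left eU
      have hV : HomVanish V X j := ((HomVanish.left_of_mem_addOf (hX.2 (j - 1) (by lia))
        hV').shift_left (by simp)).of_iso_left eV
      exact HomVanish.of_triangle_left _ hT hU hV
    exact ((h₀ (i + 1) (by lia)).shift_left (a := -1) (by lia)).of_iso_left
      ((shiftEquiv _ (1 : ℤ)).unitIso.app A)
  have step (a : ℤ) (ha : a < -1) (h : X.IsGE a) : X.IsGE (a + 1) := by
    obtain ⟨X', f, g, h, hT, hGE, -⟩ := exists_triangle_of_isGE X a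
    have h₁ : HomVanish A X' (a - 1) := fun u => by
      have := TStructure.t.isGE_shift X' (a + 1) (a - 1) 2 (by lia)
      exact TStructure.t.zero u 0 2 (by lia)
    have h₂ := HomVanish.of_triangle_right₁ _ hT (by lia : a - 1 + 1 = a) (hAX a ha) h₁
    have h₃ : Subsingleton ((homologyFunctor (ModuleCat.{0} R) a).obj X) := subsingleton_of_forall_eq 0 fun x => by
      let φ : ModuleCat.of R R ⟶ (homologyFunctor _ a).obj X :=
        ModuleCat.ofHom (LinearMap.toSpanSingleton R _ x)
      have hφ : φ = 0 := (singleFunctor _ 0).map_injective <| by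
        rw [← cancel_mono (((singleFunctors _).shiftIso a 0 a (by lia)).inv.app _),
          Functor.map_zero, zero_comp]
        exact h₂ _
      have h1 := DFunLike.congr_fun (congrArg ModuleCat.Hom.hom hφ) (1 : R)
      simpa [φ] using h1
    refine (isGE_iff _ _).2 fun i hi => ?_
    obtain hi | rfl : i < a ∨ i = a := by lia
    · exact X.isZero_of_isGE a i hi
    · exact ModuleCat.isZero_of_subsingleton _
  obtain ⟨a, ha⟩ := hX.1.exists_isGE
  by_cases haa : a < -1
  · have (n : ℕ) (hn : a + n ≤ -1) : X.IsGE (a + n) := by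
      induction n with
      | zero => simpa using ha
      | succ n ih =>
        have := step _ (by push_cast at hn; lia) (ih (by push_cast at hn; lia))
        simpa [add_assoc] using this
    have := this (-1 - a).toNat (by lia)
    rwa [show a + (-1 - a).toNat = -1 by lia] at this
  · exact TStructure.t.isGE_of_ge X (-1) a (by lia)

end IsTwoTermSilting

/-- The truncation triangle of a two-term complex. -/
lemma IsTwoTermCplx.exists_triangle (hP : IsTwoTermCplx R P) :
    ∃ (N : DerivedCategory (ModuleCat.{0} R)) (i : N ⟶ Q.obj P)
      (p : Q.obj P ⟶ (singleFunctor _ 0).obj (P.homology 0))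
      (h : (singleFunctor _ 0).obj (P.homology 0) ⟶ N⟦(1 : ℤ)⟧),
      N.IsLE (-1) ∧ Triangle.mk i p h ∈ distTriang _ := by
  have := hP.isLE
  obtain ⟨N, T, hN, hT, f, g, h, hTri⟩ := TStructure.t.exists_triangle (Q.obj P) (-1) 0 rfl
  have hNLE : N.IsLE (-1) := ⟨hN⟩
  have hTGE : T.IsGE 0 := ⟨hT⟩
  have hTLE : T.IsLE 0 := by
    rw [isLE_iff]
    intro j hj
    exact (HomologySequence.exact₃ _ hTri j (j + 1) rfl).isZero_of_both_zeros
      (((Q.obj P).isZero_of_isLE 0 j hj).eq_of_src _ _)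
      ((N.isZero_of_isLE (-1) (j + 1) (by lia)).eq_of_tgt _ _)
  obtain ⟨e⟩ := nonempty_iso_singleFunctor_homology T 0
  have : Mono ((homologyFunctor _ 0).map g) :=
    (HomologySequence.mono_homologyMap_mor₂_iff _ hTri 0).2
      ((N.isZero_of_isLE (-1) 0 (by lia)).eq_of_src _ _)
  have : Epi ((homologyFunctor _ 0).map g) :=
    (HomologySequence.epi_homologyMap_mor₂_iff _ hTri 0 1 rfl).2
      ((N.isZero_of_isLE (-1) 1 (by lia)).eq_of_tgt _ _)
  have : IsIso ((homologyFunctor _ 0).map g) := isIso_of_mono_of_epi _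
  let e' : T ≅ (singleFunctor _ 0).obj (P.homology 0) :=
    e ≪≫ (singleFunctor _ 0).mapIso ((asIso ((homologyFunctor _ 0).map g)).symm ≪≫
      (homologyFunctorFactors _ 0).app P)
  exact ⟨N, f, g ≫ e'.hom, e'.inv ≫ h, hNLE, distinguished_of_iso₃ hTri e'⟩

end TwoTerm

end Derived

lemma starChain_congr {C : Type u} [Category.{v} C] [HasZeroObject C] [Preadditive C]
    [HasShift C ℤ] [∀ n : ℤ, (shiftFunctor C n).Additive] [Pretriangulated C]
    {f g : ℕ → Set C} (n : ℕ) (h : ∀ i ≤ n, f i = g i) : starChain f n = starChain g n := by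
  induction n with
  | zero => exact h 0 le_rfl
  | succ n ih =>
    simp only [starChain, ih fun i hi => h i (by lia), h (n + 1) le_rfl]

/-- Let `gl.dim A ≤ d` and let `P` be a 2-term silting complex with
`pd H^0(P) ≤ 1`. Then `C(P) ⊆ 𝒫 * 𝒫[1] * ⋯ * 𝒫[d] * add H^0(P)[d+1]`, where
`𝒫 = add P`. -/
theorem CP_subset_starChain_add_H0
    (k A : Type) [Field k] [Ring A] [Algebra k A] [FiniteDimensional k A]
    [HasDerivedCategory.{w} (ModuleCat.{0} Aᵐᵒᵖ)]
    (P : CochainComplex (ModuleCat.{0} Aᵐᵒᵖ) ℤ)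
    (hP : IsTwoTermSilting Aᵐᵒᵖ P)
    (d : ℕ) (hgld : gldLE.{0, 0} Aᵐᵒᵖ d)
    (hH0 : pdLE.{0, 0} Aᵐᵒᵖ 1 (P.homology 0)) :
    CP P ⊆ starChain
      (fun i =>
        if i ≤ d then shiftSet (addOf (DerivedCategory.Q.obj P)) (i : ℤ)
        else shiftSet
          (addOf ((DerivedCategory.singleFunctor (ModuleCat.{0} Aᵐᵒᵖ) 0).obj
            (P.homology 0))) (i : ℤ))
      (d + 1) := by
  have : IsNoetherianRing Aᵐᵒᵖ := IsNoetherianRing.of_finite k Aᵐᵒᵖ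
  intro X hX
  have hXGE := hP.isGE_of_mem_CP hgld k hX
  obtain ⟨N, i, p, h, hN, hT⟩ := hP.1.exists_triangle
  have hPLE := hP.1.isLE
  have hTN : HomVanish ((DerivedCategory.singleFunctor (ModuleCat.{0} Aᵐᵒᵖ) 0).obj
      (P.homology 0)) N 1 := by
    have := DerivedCategory.TStructure.t.isLE_shift N (-1) 1 (-2) (by lia)
    exact hom_eq_zero_of_pdLE hH0 _ (-2) (by norm_num)
  have hXP (j : ℤ) (hj : d + 1 < j) : HomVanish X (DerivedCategory.Q.obj P) j := by
    have := DerivedCategory.TStructure.t.isLE_shift (DerivedCategory.Q.obj P) 0 j (-j) (by lia)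
    exact hX.1.hom_eq_zero hgld (-1) _ (-j) (by lia)
  have hXN : HomVanish X N (d + 1 : ℕ) := by
    have := DerivedCategory.TStructure.t.isLE_shift N (-1) (d + 1 : ℕ) (-2 - d)
      (by push_cast; lia)
    exact hX.1.hom_eq_zero hgld (-1) _ (-2 - d) (by lia)
  have key := mem_star_addOf_of_homVanish (k := k) hP.homVanish (hP.finite_hom hgld k) hT hTN d
    (hP.mem_aisle hgld hX) hXP hXN
  rw [starChain, starChain_congr d (g := fun i : ℕ =>
    shiftSet (addOf (DerivedCategory.Q.obj P)) (i : ℤ)) fun i hi => if_pos hi,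
    if_neg (by lia)]
  exact key

end

end TwoTermSilting
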